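/- Let f, g and h be entire functions given by everywhere absolutely convergent vector valued Dirichlet series, and let p ≥ 0, q ≥ 0, m ≥ 0 be integers. Assume 0 < λ_h^{(m,q)}(f) ≤ ρ_h^{(m,q)}(f) < +∞, 0 < λ_h^{(m,p)}(g) ≤ ρ_h^{(m,p)}(g) < +∞, and that the indicators τ_h^{(m,q)}(f), τ̄_h^{(m,q)}(f), τ̄_h^{(m,p)}(g), Δ_h^{(m,p)}(g), Δ̄_h^{(m,p)}(g) are all positive and finite. Then (τ_h^{(m,q)}(f)/τ̄_h^{(m,p)}(g))^{1/λ_h^{(m,p)}(g)} ≤ τ_g^{(p,q)}(f) ≤ min{ (τ_h^{(m,q)}(f)/Δ̄_h^{(m,p)}(g))^{1/ρ_h^{(m,p)}(g)}, (τ̄_h^{(m,q)}(f)/Δ_h^{(m,p)}(g))^{1/ρ_h^{(m,p)}(g)} }. -/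

import Mathlib

open Filter Topology

noncomputable section

/-- An entire function given by an everywhere absolutely convergent
vector valued Dirichlet series, with coefficients in a Banach space `E`. -/
structure VVDS (E : Type*) [NormedAddCommGroup E] [NormedSpace ℂ E] [CompleteSpace E] where
  a : ℕ → E
  lam : ℕ → ℝ
  lam_pos : ∀ n, 0 < lam n
  lam_strictMono : StrictMono lam
  lam_tendsto : Tendsto lam atTop atTop
  log_index_bound : ∃ D : ℝ, ∀ᶠ n : ℕ in atTop, Real.log (n : ℝ) / lam n ≤ D
  coeff_decay : Tendsto (fun n => Real.log ‖a n‖ / lam n) atTop atBot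
  abs_conv : ∀ s : ℂ, Summable (fun n => Real.exp (s.re * lam n) * ‖a n‖)

variable {E F G : Type*} [NormedAddCommGroup E] [NormedSpace ℂ E] [CompleteSpace E]
  [NormedAddCommGroup F] [NormedSpace ℂ F] [CompleteSpace F]
  [NormedAddCommGroup G] [NormedSpace ℂ G] [CompleteSpace G]

/-- The entire function defined by the vector valued Dirichlet series. -/
def VVDS.toFun (f : VVDS E) (s : ℂ) : E := ∑' n, Complex.exp (s * (f.lam n : ℂ)) • f.a n

/-- The maximum modulus function `M_f(σ) = sup_t ‖f(σ+it)‖`. -/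
def VVDS.M (f : VVDS E) (σ : ℝ) : ℝ := ⨆ t : ℝ, ‖f.toFun ((σ : ℂ) + (t : ℂ) * Complex.I)‖

/-- The inverse function of the maximum modulus function. -/
def VVDS.Minv (f : VVDS E) (y : ℝ) : ℝ := sInf {σ : ℝ | y ≤ f.M σ}

/-- The (p,q)-th relative Ritt order of `f` with respect to `g`. -/
def relRittOrder (p q : ℕ) (f : VVDS E) (g : VVDS F) : EReal :=
  limsup (fun σ : ℝ =>
    ((Real.log^[p] (g.Minv (f.M σ)) / Real.log^[q] σ : ℝ) : EReal)) atTop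

/-- The (p,q)-th relative Ritt lower order of `f` with respect to `g`. -/
def relRittLowerOrder (p q : ℕ) (f : VVDS E) (g : VVDS F) : EReal :=
  liminf (fun σ : ℝ =>
    ((Real.log^[p] (g.Minv (f.M σ)) / Real.log^[q] σ : ℝ) : EReal)) atTop

/-- The (p,q)-th relative Ritt type of `f` with respect to `g`. -/
def relRittType (p q : ℕ) (f : VVDS E) (g : VVDS F) : EReal :=
  limsup (fun σ : ℝ =>
    ((Real.log^[p-1] (g.Minv (f.M σ)) /
      (Real.log^[q-1] σ) ^ (relRittOrder p q f g).toReal : ℝ) : EReal)) atTop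

/-- The (p,q)-th relative Ritt lower type of `f` with respect to `g`. -/
def relRittLowerType (p q : ℕ) (f : VVDS E) (g : VVDS F) : EReal :=
  liminf (fun σ : ℝ =>
    ((Real.log^[p-1] (g.Minv (f.M σ)) /
      (Real.log^[q-1] σ) ^ (relRittOrder p q f g).toReal : ℝ) : EReal)) atTop

/-- The (p,q)-th relative Ritt weak type of `f` with respect to `g`. -/
def relRittWeakType (p q : ℕ) (f : VVDS E) (g : VVDS F) : EReal :=
  liminf (fun σ : ℝ =>
    ((Real.log^[p-1] (g.Minv (f.M σ)) /
      (Real.log^[q-1] σ) ^ (relRittLowerOrder p q f g).toReal : ℝ) : EReal)) atTop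

/-- The growth indicator `τ̄_g^{(p,q)}(f)`. -/
def relRittUpperWeakType (p q : ℕ) (f : VVDS E) (g : VVDS F) : EReal :=
  limsup (fun σ : ℝ =>
    ((Real.log^[p-1] (g.Minv (f.M σ)) /
      (Real.log^[q-1] σ) ^ (relRittLowerOrder p q f g).toReal : ℝ) : EReal)) atTop

section VVDSBasic

variable {E : Type*} [NormedAddCommGroup E] [NormedSpace ℂ E] [CompleteSpace E]

/-- The sum of the norms. -/
def VVDS.S (f : VVDS E) (σ : ℝ) : ℝ := ∑' n, Real.exp (σ * f.lam n) * ‖f.a n‖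

lemma VVDS.summable_S (f : VVDS E) (σ : ℝ) :
    Summable (fun n => Real.exp (σ * f.lam n) * ‖f.a n‖) := by
  simpa using f.abs_conv (σ : ℂ)

lemma VVDS.norm_term (f : VVDS E) (σ t : ℝ) (n : ℕ) :
    ‖Complex.exp (((σ : ℂ) + (t : ℂ) * Complex.I) * (f.lam n : ℂ)) • f.a n‖
      = Real.exp (σ * f.lam n) * ‖f.a n‖ := by
  rw [norm_smul, Complex.norm_exp]
  simp

lemma VVDS.summable_term (f : VVDS E) (σ t : ℝ) :
    Summable (fun n => Complex.exp (((σ : ℂ) + (t : ℂ) * Complex.I) * (f.lam n : ℂ)) • f.a n) := by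
  apply Summable.of_norm
  simp only [f.norm_term]
  exact f.summable_S σ

lemma VVDS.norm_toFun_le (f : VVDS E) (σ t : ℝ) :
    ‖f.toFun ((σ : ℂ) + (t : ℂ) * Complex.I)‖ ≤ f.S σ := by
  unfold VVDS.toFun VVDS.S
  refine tsum_of_norm_bounded (f.summable_S σ).hasSum (fun n => ?_)
  rw [f.norm_term]

lemma VVDS.bdd (f : VVDS E) (σ : ℝ) :
    BddAbove (Set.range fun t : ℝ => ‖f.toFun ((σ : ℂ) + (t : ℂ) * Complex.I)‖) :=
  ⟨f.S σ, by rintro _ ⟨t, rfl⟩; exact f.norm_toFun_le σ t⟩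

lemma VVDS.norm_le_M (f : VVDS E) (σ t : ℝ) :
    ‖f.toFun ((σ : ℂ) + (t : ℂ) * Complex.I)‖ ≤ f.M σ := le_ciSup (f.bdd σ) t

lemma VVDS.M_le_S (f : VVDS E) (σ : ℝ) : f.M σ ≤ f.S σ := ciSup_le (f.norm_toFun_le σ)

lemma VVDS.S_mono (f : VVDS E) : Monotone f.S := by
  intro x y hxy
  refine (f.summable_S x).tsum_le_tsum (fun n => ?_) (f.summable_S y)
  have := (f.lam_pos n).le
  gcongr

lemma VVDS.S_cont (f : VVDS E) : Continuous f.S := by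
  rw [continuous_iff_continuousAt]
  intro x
  have : ContinuousOn f.S (Set.Iic (x + 1)) := by
    refine continuousOn_tsum (fun n => by fun_prop) (f.summable_S (x + 1)) ?_
    intro n y hy
    have h1 := (f.lam_pos n).le
    have hy : y ≤ x + 1 := hy
    rw [Real.norm_of_nonneg (by positivity)]
    gcongr
  exact this.continuousAt (Iic_mem_nhds (by linarith))

lemma VVDS.M_sub_le (f : VVDS E) {x y : ℝ} (hxy : x ≤ y) : |f.M x - f.M y| ≤ f.S y - f.S x := by
  have key : ∀ t : ℝ, ‖f.toFun ((x : ℂ) + (t : ℂ) * Complex.I)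
      - f.toFun ((y : ℂ) + (t : ℂ) * Complex.I)‖ ≤ f.S y - f.S x := by
    intro t
    unfold VVDS.toFun VVDS.S
    rw [← (f.summable_term x t).tsum_sub (f.summable_term y t),
      ← (f.summable_S y).tsum_sub (f.summable_S x)]
    refine tsum_of_norm_bounded ((f.summable_S y).sub (f.summable_S x)).hasSum (fun n => ?_)
    rw [← sub_smul, norm_smul, ← sub_mul]
    gcongr
    have e : ∀ z : ℝ, Complex.exp (((z : ℂ) + (t : ℂ) * Complex.I) * (f.lam n : ℂ))
        = ((Real.exp (z * f.lam n) : ℝ) : ℂ) * Complex.exp ((t * f.lam n : ℝ) * Complex.I) := by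
      intro z
      rw [Complex.ofReal_exp, ← Complex.exp_add]
      congr 1
      push_cast
      ring
    rw [e, e, ← sub_mul, norm_mul, Complex.norm_exp_ofReal_mul_I, mul_one, ← Complex.ofReal_sub,
      Complex.norm_real, Real.norm_eq_abs, abs_sub_comm, abs_of_nonneg]
    have := (f.lam_pos n).le
    rw [sub_nonneg]
    gcongr
  rw [abs_le]
  constructor
  · have : f.M y ≤ f.M x + (f.S y - f.S x) := by
      refine ciSup_le fun t => ?_
      have h1 := key t
      have h2 := f.norm_le_M x t
      rw [norm_sub_rev] at h1
      have h3 := norm_sub_norm_le (f.toFun ((y : ℂ) + (t : ℂ) * Complex.I))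
        (f.toFun ((x : ℂ) + (t : ℂ) * Complex.I))
      linarith
    linarith
  · have : f.M x ≤ f.M y + (f.S y - f.S x) := by
      refine ciSup_le fun t => ?_
      have h1 := key t
      have h2 := f.norm_le_M y t
      have h3 := norm_sub_norm_le (f.toFun ((x : ℂ) + (t : ℂ) * Complex.I))
        (f.toFun ((y : ℂ) + (t : ℂ) * Complex.I))
      linarith
    linarith

lemma VVDS.M_cont (f : VVDS E) : Continuous f.M := by
  rw [continuous_iff_continuousAt]
  intro x
  have hb : ∀ y, dist (f.M y) (f.M x) ≤ |f.S y - f.S x| := by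
    intro y
    rw [Real.dist_eq]
    rcases le_total x y with h | h
    · rw [abs_sub_comm]
      exact (f.M_sub_le h).trans (le_abs_self _)
    · rw [abs_sub_comm (f.S y)]
      exact (f.M_sub_le h).trans (le_abs_self _)
  rw [ContinuousAt, tendsto_iff_dist_tendsto_zero]
  refine squeeze_zero (fun _ => dist_nonneg) hb ?_
  have : Tendsto (fun y => |f.S y - f.S x|) (𝓝 x) (𝓝 |f.S x - f.S x|) :=
    ((f.S_cont.tendsto x).sub_const _).abs
  simpa using this

lemma exp_mean_tendsto {δ : ℝ} (hδ : δ ≠ 0) :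
    Tendsto (fun T : ℝ => (T : ℂ)⁻¹ * ∫ t in (0:ℝ)..T, Complex.exp ((δ * Complex.I) * t))
      atTop (𝓝 0) := by
  have hc : (δ * Complex.I : ℂ) ≠ 0 := by simp [hδ]
  simp_rw [integral_exp_mul_complex hc]
  rw [tendsto_zero_iff_norm_tendsto_zero]
  have h0 : Tendsto (fun T : ℝ => T⁻¹ * (2 / |δ|)) atTop (𝓝 0) := by
    simpa using tendsto_inv_atTop_zero.mul_const (2 / |δ|)
  refine squeeze_zero' (Eventually.of_forall fun _ => norm_nonneg _) ?_ h0
  filter_upwards [eventually_gt_atTop 0] with T hT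
  rw [norm_mul, norm_inv, Complex.norm_real, Real.norm_of_nonneg hT.le, norm_div]
  have : ‖(δ * Complex.I : ℂ)‖ = |δ| := by simp
  rw [this]
  gcongr
  refine (norm_sub_le _ _).trans ?_
  have h1 : ∀ r : ℝ, ‖Complex.exp (δ * Complex.I * r)‖ = 1 := by
    intro r; rw [Complex.norm_exp]; simp
  rw [h1, h1]; norm_num

lemma VVDS.coeff_le_M (f : VVDS E) (σ : ℝ) (n : ℕ) :
    Real.exp (σ * f.lam n) * ‖f.a n‖ ≤ f.M σ := by
  set b : ℕ → E := fun k => Complex.exp ((σ : ℂ) * f.lam k) • f.a k with hb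
  have hbn : ∀ k, ‖b k‖ = Real.exp (σ * f.lam k) * ‖f.a k‖ := by
    intro k
    simp only [hb, norm_smul, Complex.norm_exp]
    simp
  set c : ℕ → ℝ := fun k => f.lam k - f.lam n with hc
  have hexpn : ∀ (k : ℕ) (t : ℝ), ‖Complex.exp ((c k * Complex.I) * t)‖ = 1 := by
    intro k t; rw [Complex.norm_exp]; simp
  have hsumb : Summable (fun k => ‖b k‖) := by simp only [hbn]; exact f.summable_S σ
  have hpt : ∀ t : ℝ, ‖∑' k, Complex.exp ((c k * Complex.I) * t) • b k‖ ≤ f.M σ := by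
    intro t
    have : ∑' k, Complex.exp ((c k * Complex.I) * t) • b k
        = Complex.exp ((-(t * f.lam n) : ℝ) * Complex.I)
          • f.toFun ((σ : ℂ) + (t : ℂ) * Complex.I) := by
      unfold VVDS.toFun
      rw [← (f.summable_term σ t).tsum_const_smul]
      congr 1
      ext k
      simp only [hb, smul_smul, ← Complex.exp_add]
      congr 2
      simp only [hc]
      push_cast
      ring
    rw [this, norm_smul, Complex.norm_exp_ofReal_mul_I, one_mul]
    exact f.norm_le_M σ t
  have hint : ∀ T : ℝ, HasSum (fun k => ∫ t in (0:ℝ)..T, Complex.exp ((c k * Complex.I) * t) • b k)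
      (∫ t in (0:ℝ)..T, ∑' k, Complex.exp ((c k * Complex.I) * t) • b k) := by
    intro T
    refine intervalIntegral.hasSum_integral_of_dominated_convergence (fun k _ => ‖b k‖)
      (fun k => ?_) (fun k => ?_) ?_ ?_ ?_
    · exact (Continuous.aestronglyMeasurable (by fun_prop))
    · refine Eventually.of_forall fun t _ => ?_
      rw [norm_smul, hexpn, one_mul]
    · exact Eventually.of_forall fun t _ => hsumb
    · exact intervalIntegrable_const
    · refine Eventually.of_forall fun t _ => ?_
      refine Summable.hasSum (Summable.of_norm ?_)
      simp only [norm_smul, hexpn, one_mul]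
      exact hsumb
  set A : ℝ → ℕ → E := fun T k =>
    ((T : ℂ)⁻¹ * ∫ t in (0:ℝ)..T, Complex.exp ((c k * Complex.I) * t)) • b k with hA
  have hAsum : ∀ T : ℝ, ∑' k, A T k
      = (T : ℂ)⁻¹ • ∫ t in (0:ℝ)..T, ∑' k, Complex.exp ((c k * Complex.I) * t) • b k := by
    intro T
    rw [← (hint T).tsum_eq, ← (hint T).summable.tsum_const_smul]
    congr 1
    ext k
    rw [hA, intervalIntegral.integral_smul_const, smul_smul]
  have hle : ∀ T : ℝ, 0 < T → ‖∑' k, A T k‖ ≤ f.M σ := by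
    intro T hT
    rw [hAsum, norm_smul, norm_inv, Complex.norm_real, Real.norm_of_nonneg hT.le]
    have := intervalIntegral.norm_integral_le_of_norm_le_const (a := (0:ℝ)) (b := T)
      (f := fun t : ℝ => ∑' k, Complex.exp ((c k * Complex.I) * t) • b k) (C := f.M σ)
      (fun t _ => hpt t)
    rw [sub_zero, abs_of_pos hT] at this
    rw [inv_mul_le_iff₀ hT]
    linarith
  have hlim : Tendsto (fun T : ℝ => ∑' k, A T k) atTop
      (𝓝 (∑' k, if k = n then b n else 0)) := by
    refine tendsto_tsum_of_dominated_convergence (bound := fun k => ‖b k‖) hsumb ?_ ?_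
    · intro k
      by_cases hk : k = n
      · subst hk
        simp only [if_true]
        refine tendsto_const_nhds.congr' ?_
        filter_upwards [eventually_gt_atTop 0] with T hT
        have : (T : ℂ) ≠ 0 := by exact_mod_cast hT.ne'
        simp [hA, hc, this]
      · simp only [hk, if_false]
        have hck : c k ≠ 0 := by
          simp only [hc, sub_ne_zero]
          exact fun h => hk (f.lam_strictMono.injective h)
        simpa using (exp_mean_tendsto hck).smul_const (b k)
    · filter_upwards [eventually_gt_atTop 0] with T hT k
      rw [hA]
      simp only
      rw [norm_smul, norm_mul, norm_inv, Complex.norm_real, Real.norm_of_nonneg hT.le]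
      have := intervalIntegral.norm_integral_le_of_norm_le_const (a := (0:ℝ)) (b := T)
        (f := fun t : ℝ => Complex.exp ((c k * Complex.I) * t)) (C := 1)
        (fun t _ => (hexpn k t).le)
      rw [sub_zero, abs_of_pos hT, one_mul] at this
      refine mul_le_of_le_one_left (norm_nonneg _) ?_
      rw [inv_mul_le_iff₀ hT]
      linarith
  rw [tsum_ite_eq] at hlim
  rw [← hbn]
  refine le_of_tendsto hlim.norm ?_
  filter_upwards [eventually_gt_atTop 0] with T hT using hle T hT

lemma VVDS.M_tendsto (f : VVDS E) : Tendsto f.M atTop atTop := by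
  obtain ⟨n, hn⟩ : ∃ n, f.a n ≠ 0 := by
    obtain ⟨n, hn⟩ := (f.coeff_decay.eventually_lt_atBot 0).exists
    refine ⟨n, fun h => ?_⟩
    simp [h] at hn
  refine tendsto_atTop_mono (fun σ => f.coeff_le_M σ n) ?_
  refine Tendsto.atTop_mul_const (norm_pos_iff.2 hn) ?_
  exact Real.tendsto_exp_atTop.comp (tendsto_id.atTop_mul_const (f.lam_pos n))

lemma VVDS.Minv_spec (f : VVDS E) {y : ℝ} (hy : f.S 0 < y) :
    f.M (f.Minv y) = y ∧ ∀ s, y ≤ f.M s → f.Minv y ≤ s := by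
  have hb : BddBelow {σ : ℝ | y ≤ f.M σ} := by
    refine ⟨0, fun s hs => ?_⟩
    by_contra hlt
    push Not at hlt
    have h1 := f.S_mono hlt.le
    have h2 := f.M_le_S s
    have h3 : y ≤ f.M s := hs
    linarith
  have hne : {σ : ℝ | y ≤ f.M σ}.Nonempty := (f.M_tendsto.eventually_ge_atTop y).exists
  have hcl : IsClosed {σ : ℝ | y ≤ f.M σ} := isClosed_le continuous_const f.M_cont
  refine ⟨le_antisymm ?_ (hcl.csInf_mem hne hb), fun s hs => csInf_le hb hs⟩
  have hlim : Tendsto f.M (𝓝[<] (f.Minv y)) (𝓝 (f.M (f.Minv y))) :=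
    (f.M_cont.tendsto _).mono_left nhdsWithin_le_nhds
  refine le_of_tendsto hlim ?_
  filter_upwards [self_mem_nhdsWithin] with s hs
  by_contra hlt
  push Not at hlt
  exact absurd (csInf_le hb (show s ∈ {σ : ℝ | y ≤ f.M σ} from hlt.le)) (not_le.2 hs)

lemma VVDS.Minv_tendsto (f : VVDS E) : Tendsto f.Minv atTop atTop := by
  rw [tendsto_atTop]
  intro K
  filter_upwards [eventually_gt_atTop (f.S 0), eventually_gt_atTop (f.S K)] with y h0 hK
  by_contra hlt
  push Not at hlt
  have h1 := f.S_mono hlt.le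
  have h2 := f.M_le_S (f.Minv y)
  rw [(f.Minv_spec h0).1] at h2
  linarith

end VVDSBasic

section RealCore

lemma log_iter_tendsto (k : ℕ) : Tendsto (Real.log^[k]) atTop atTop := by
  induction k with
  | zero => exact tendsto_id
  | succ k ih =>
    rw [Function.iterate_succ']
    exact Real.tendsto_log_atTop.comp ih

lemma log_iter_mono (k : ℕ) : ∃ K : ℝ, MonotoneOn (Real.log^[k]) (Set.Ici K) := by
  induction k with
  | zero => exact ⟨0, fun x _ y _ h => h⟩
  | succ k ih =>
    obtain ⟨K, hK⟩ := ih
    obtain ⟨K', hK'⟩ := eventually_atTop.1 ((log_iter_tendsto k).eventually_gt_atTop 0)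
    refine ⟨max K K', fun x hx y hy hxy => ?_⟩
    have hx : max K K' ≤ x := hx
    have hy : max K K' ≤ y := hy
    rw [Function.iterate_succ_apply', Function.iterate_succ_apply']
    exact Real.log_le_log (hK' x ((le_max_right _ _).trans hx))
      (hK ((le_max_left _ _).trans hx) ((le_max_left _ _).trans hy) hxy)

lemma alg_iff {K B P r t a : ℝ} (hK : 0 < K) (hB : 0 < B) (hP : 0 < P) (hr : 0 < r) (ht : 0 < t) :
    (t * B ^ a ≤ t / K ^ r * P ^ r ↔ K * B ^ (a / r) ≤ P) ∧
    (t / K ^ r * P ^ r ≤ t * B ^ a ↔ P ≤ K * B ^ (a / r)) := by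
  have hKr : 0 < K ^ r := Real.rpow_pos_of_pos hK r
  have e : (K * B ^ (a / r)) ^ r = K ^ r * B ^ a := by
    rw [Real.mul_rpow hK.le (Real.rpow_nonneg hB.le _), ← Real.rpow_mul hB.le,
      div_mul_cancel₀ _ hr.ne']
  have hQ : 0 ≤ K * B ^ (a / r) := by positivity
  have e2 : t * B ^ a = (t / K ^ r) * (K * B ^ (a / r)) ^ r := by
    rw [e]; field_simp
  have hpos : 0 < t / K ^ r := by positivity
  rw [e2, mul_le_mul_iff_right₀ hpos, mul_le_mul_iff_right₀ hpos,
    Real.rpow_le_rpow_iff hQ hP.le hr, Real.rpow_le_rpow_iff hP.le hQ hr]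
  exact ⟨Iff.rfl, Iff.rfl⟩

lemma ev_le_of_limsup {x y : ℝ → ℝ} {T T' : ℝ}
    (hx : limsup (fun σ => ((x σ / y σ : ℝ) : EReal)) atTop = (T : EReal)) (hT : T < T')
    (hy : ∀ᶠ σ in atTop, 0 < y σ) : ∀ᶠ σ in atTop, x σ ≤ T' * y σ := by
  have := eventually_lt_of_limsup_lt (hx.trans_lt (EReal.coe_lt_coe_iff.2 hT))
  filter_upwards [this, hy] with σ h1 h2
  exact ((div_lt_iff₀ h2).1 (EReal.coe_lt_coe_iff.1 h1)).le

lemma ev_ge_of_liminf {x y : ℝ → ℝ} {T T' : ℝ}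
    (hx : liminf (fun σ => ((x σ / y σ : ℝ) : EReal)) atTop = (T : EReal)) (hT : T' < T)
    (hy : ∀ᶠ σ in atTop, 0 < y σ) : ∀ᶠ σ in atTop, T' * y σ ≤ x σ := by
  have := eventually_lt_of_lt_liminf ((EReal.coe_lt_coe_iff.2 hT).trans_eq hx.symm)
  filter_upwards [this, hy] with σ h1 h2
  exact ((lt_div_iff₀ h2).1 (EReal.coe_lt_coe_iff.1 h1)).le

lemma fr_le_of_liminf {x y : ℝ → ℝ} {T T' : ℝ}
    (hx : liminf (fun σ => ((x σ / y σ : ℝ) : EReal)) atTop = (T : EReal)) (hT : T < T')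
    (hy : ∀ᶠ σ in atTop, 0 < y σ) : ∃ᶠ σ in atTop, x σ ≤ T' * y σ := by
  have := frequently_lt_of_liminf_lt (by isBoundedDefault)
    (hx.trans_lt (EReal.coe_lt_coe_iff.2 hT))
  refine (this.and_eventually hy).mono fun σ h => ?_
  exact ((div_lt_iff₀ h.2).1 (EReal.coe_lt_coe_iff.1 h.1)).le

lemma fr_ge_of_limsup {x y : ℝ → ℝ} {T T' : ℝ}
    (hx : limsup (fun σ => ((x σ / y σ : ℝ) : EReal)) atTop = (T : EReal)) (hT : T' < T)
    (hy : ∀ᶠ σ in atTop, 0 < y σ) : ∃ᶠ σ in atTop, T' * y σ ≤ x σ := by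
  have := frequently_lt_of_lt_limsup (by isBoundedDefault)
    ((EReal.coe_lt_coe_iff.2 hT).trans_eq hx.symm)
  refine (this.and_eventually hy).mono fun σ h => ?_
  exact ((lt_div_iff₀ h.2).1 (EReal.coe_lt_coe_iff.1 h.1)).le

lemma ev_rpow_pos {B : ℝ → ℝ} (hB : Tendsto B atTop atTop) (a : ℝ) :
    ∀ᶠ σ in atTop, 0 < B σ ^ a := by
  filter_upwards [hB.eventually_gt_atTop 0] with σ h using Real.rpow_pos_of_pos h a

/-- the lower bound -/
lemma core_lower {u v B P μ : ℝ → ℝ} {a r τ T : ℝ} (hr : 0 < r)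
    (hB : Tendsto B atTop atTop) (hP : Tendsto P atTop atTop) (hμ : Tendsto μ atTop atTop)
    (hcomp : ∀ᶠ σ in atTop, v (μ σ) = u σ) (hτ0 : 0 < τ) (hT0 : 0 < T)
    (hτ : liminf (fun σ => ((u σ / B σ ^ a : ℝ) : EReal)) atTop = (τ : EReal))
    (hT : limsup (fun σ => ((v σ / P σ ^ r : ℝ) : EReal)) atTop = (T : EReal)) :
    (((τ / T) ^ (1 / r) : ℝ) : EReal) ≤
      liminf (fun σ => ((P (μ σ) / B σ ^ (a / r) : ℝ) : EReal)) atTop := by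
  refine le_of_forall_lt_imp_le_of_dense fun x hx => ?_
  have hK0 : 0 < (τ / T) ^ (1 / r) := by positivity
  obtain ⟨K, hxK, hKK⟩ : ∃ K : ℝ, x ≤ (K : EReal) ∧ 0 < K ∧ K < (τ / T) ^ (1 / r) := by
    obtain ⟨K, h1, h2⟩ := EReal.exists_between_coe_real
      (show max x 0 < (((τ / T) ^ (1 / r) : ℝ) : EReal) from max_lt hx (by exact_mod_cast hK0))
    refine ⟨K, (le_max_left _ _).trans h1.le, ?_, by exact_mod_cast h2⟩
    exact_mod_cast (le_max_right _ _).trans_lt h1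
  obtain ⟨hKpos, hKlt⟩ := hKK
  refine hxK.trans ?_
  have hKr : 0 < K ^ r := Real.rpow_pos_of_pos hKpos r
  have h1 : K ^ r < τ / T := by
    have := Real.rpow_lt_rpow hKpos.le hKlt hr
    rwa [← Real.rpow_mul (by positivity), one_div_mul_cancel hr.ne', Real.rpow_one] at this
  rw [lt_div_iff₀ hT0] at h1
  obtain ⟨t, ht1, ht2⟩ := exists_between h1
  have ht0 : 0 < t := lt_trans (by positivity) ht1
  have hTt : T < t / K ^ r := by rw [lt_div_iff₀ hKr]; linarith
  have A1 := ev_ge_of_liminf hτ ht2 (ev_rpow_pos hB a)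
  have A2 := hμ.eventually (ev_le_of_limsup hT hTt (ev_rpow_pos hP r))
  refine le_liminf_of_le (by isBoundedDefault) ?_
  filter_upwards [A1, A2, hcomp, hB.eventually_gt_atTop 0,
    (hP.comp hμ).eventually_gt_atTop 0] with σ h1 h2 h3 h4 h5
  rw [EReal.coe_le_coe_iff, le_div_iff₀ (Real.rpow_pos_of_pos h4 _)]
  refine (alg_iff (a := a) hKpos h4 h5 hr ht0).1.1 ?_
  rw [h3] at h2
  exact h1.trans h2

/-- helper for the upper bounds -/
lemma core_upper {w : ℝ → ℝ} {r τ T : ℝ} (hr : 0 < r) (hτ0 : 0 < τ) (hT0 : 0 < T)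
    (H : ∀ K t : ℝ, 0 < K → 0 < t → τ < t → t / K ^ r < T → ∃ᶠ σ in atTop, w σ ≤ K) :
    liminf (fun σ => ((w σ : ℝ) : EReal)) atTop ≤ (((τ / T) ^ (1 / r) : ℝ) : EReal) := by
  refine le_of_forall_gt_imp_ge_of_dense fun x hx => ?_
  have hK0 : 0 < (τ / T) ^ (1 / r) := by positivity
  obtain ⟨K, h1, h2⟩ := EReal.exists_between_coe_real hx
  refine le_trans ?_ h2.le
  have hKlt : (τ / T) ^ (1 / r) < K := by exact_mod_cast h1
  have hKpos := hK0.trans hKlt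
  have hKr : 0 < K ^ r := Real.rpow_pos_of_pos hKpos r
  have h1 : τ / T < K ^ r := by
    have := Real.rpow_lt_rpow hK0.le hKlt hr
    rwa [← Real.rpow_mul (by positivity), one_div_mul_cancel hr.ne', Real.rpow_one] at this
  rw [div_lt_iff₀ hT0] at h1
  obtain ⟨t, ht1, ht2⟩ := exists_between h1
  refine liminf_le_of_frequently_le ?_ (by isBoundedDefault)
  refine (H K t hKpos (hτ0.trans ht1) ht1 ?_).mono fun σ h => by exact_mod_cast h
  rw [div_lt_iff₀ hKr]; linarith

lemma core_upper1 {u v B P μ : ℝ → ℝ} {a r τ T : ℝ} (hr : 0 < r)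
    (hB : Tendsto B atTop atTop) (hP : Tendsto P atTop atTop) (hμ : Tendsto μ atTop atTop)
    (hcomp : ∀ᶠ σ in atTop, v (μ σ) = u σ) (hτ0 : 0 < τ) (hT0 : 0 < T)
    (hτ : liminf (fun σ => ((u σ / B σ ^ a : ℝ) : EReal)) atTop = (τ : EReal))
    (hT : liminf (fun σ => ((v σ / P σ ^ r : ℝ) : EReal)) atTop = (T : EReal)) :
    liminf (fun σ => ((P (μ σ) / B σ ^ (a / r) : ℝ) : EReal)) atTop ≤
      (((τ / T) ^ (1 / r) : ℝ) : EReal) := by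
  refine core_upper hr hτ0 hT0 fun K t hK ht ht1 ht2 => ?_
  have A1 := fr_le_of_liminf hτ ht1 (ev_rpow_pos hB a)
  have A2 := hμ.eventually (ev_ge_of_liminf hT ht2 (ev_rpow_pos hP r))
  refine (A1.and_eventually (A2.and (hcomp.and ((hB.eventually_gt_atTop 0).and
    ((hP.comp hμ).eventually_gt_atTop 0))))).mono ?_
  rintro σ ⟨h1, h2, h3, h4, h5⟩
  rw [div_le_iff₀ (Real.rpow_pos_of_pos h4 _)]
  refine (alg_iff (a := a) hK h4 h5 hr ht).2.1 ?_
  rw [h3] at h2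
  exact h2.trans h1

lemma core_upper2 {u v B P μ κ : ℝ → ℝ} {a r τ T : ℝ} (hr : 0 < r)
    (hB : Tendsto B atTop atTop) (hP : Tendsto P atTop atTop) (hμ : Tendsto μ atTop atTop)
    (hκ : Tendsto κ atTop atTop) (hmon : ∃ K : ℝ, MonotoneOn P (Set.Ici K))
    (hcomp : ∀ᶠ σ in atTop, v (μ σ) = u σ)
    (hκμ : ∀ᶠ s in atTop, v (μ (κ s)) = v s ∧ μ (κ s) ≤ s) (hτ0 : 0 < τ) (hT0 : 0 < T)
    (hτ : limsup (fun σ => ((u σ / B σ ^ a : ℝ) : EReal)) atTop = (τ : EReal))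
    (hT : limsup (fun σ => ((v σ / P σ ^ r : ℝ) : EReal)) atTop = (T : EReal)) :
    liminf (fun σ => ((P (μ σ) / B σ ^ (a / r) : ℝ) : EReal)) atTop ≤
      (((τ / T) ^ (1 / r) : ℝ) : EReal) := by
  obtain ⟨Q, hQ⟩ := hmon
  refine core_upper hr hτ0 hT0 fun K t hK ht ht1 ht2 => ?_
  have A1 := hκ.eventually (ev_le_of_limsup hτ ht1 (ev_rpow_pos hB a))
  have A2 := fr_ge_of_limsup hT ht2 (ev_rpow_pos hP r)
  refine hκ.frequently ?_
  have hμκ := hμ.comp hκ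
  refine (A2.and_eventually (A1.and (hκμ.and ((hκ.eventually hcomp).and
    (((hB.comp hκ).eventually_gt_atTop 0).and
    (((hP.comp hμκ).eventually_gt_atTop 0).and (hμκ.eventually_ge_atTop Q))))))).mono ?_
  rintro s ⟨h2, h1, ⟨h3, h3'⟩, h3'', h4, h5, h6⟩
  simp only [Function.comp] at h4 h5 h6
  rw [div_le_iff₀ (Real.rpow_pos_of_pos h4 _)]
  refine (alg_iff (a := a) hK h4 h5 hr ht).2.1 ?_
  rw [← h3''] at h1
  refine le_trans ?_ h1
  rw [h3]
  refine le_trans ?_ h2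
  have hle : P (μ (κ s)) ≤ P s := hQ h6 (h6.trans h3') h3'
  have hKr : 0 < K ^ r := Real.rpow_pos_of_pos hK r
  gcongr

/-- comparison of exponents -/
lemma exponent_le {B : ℝ → ℝ} (hB : Tendsto B atTop atTop) {c C a b : ℝ} (hc : 0 < c)
    (h : ∀ᶠ σ in atTop, c * B σ ^ a ≤ C * B σ ^ b) : a ≤ b := by
  by_contra hlt
  push Not at hlt
  have h1 : Tendsto (fun σ => B σ ^ (a - b)) atTop atTop :=
    (tendsto_rpow_atTop (sub_pos.2 hlt)).comp hB
  obtain ⟨σ, h2, h3, h4⟩ := (h.and ((h1.eventually_gt_atTop (C / c)).and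
    (hB.eventually_gt_atTop 0))).exists
  have h5 : 0 < B σ ^ b := Real.rpow_pos_of_pos h4 b
  rw [Real.rpow_sub h4, div_lt_div_iff₀ hc h5] at h3
  linarith

lemma contra_log {B u : ℝ → ℝ} (hB : Tendsto B atTop atTop) {c C a : ℝ} (hc : 0 < c) (ha : 0 < a)
    (hC : 0 < C)
    (h1 : ∀ᶠ σ in atTop, u σ ≤ C * Real.log (B σ)) (h2 : ∀ᶠ σ in atTop, c * B σ ^ a ≤ u σ) :
    False := by
  have hlo := (isLittleO_log_rpow_atTop ha).bound (show 0 < c / (2 * C) by positivity)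
  obtain ⟨σ, h1, h2, h3, h4⟩ := (h1.and (h2.and ((hB.eventually hlo).and
    (hB.eventually_gt_atTop 0)))).exists
  have h5 : 0 < B σ ^ a := Real.rpow_pos_of_pos h4 a
  rw [Real.norm_of_nonneg h5.le] at h3
  have h6 := (le_abs_self _).trans h3
  have h7 : C * Real.log (B σ) ≤ C * (c / (2 * C) * B σ ^ a) := by gcongr
  have h8 : C * (c / (2 * C) * B σ ^ a) = c * B σ ^ a / 2 := by field_simp
  have : 0 < c * B σ ^ a := by positivity
  linarith

lemma contra_exp {u : ℝ → ℝ} {c C a : ℝ} (hc : 0 < c) (ha : 0 < a) (hC : 0 < C)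
    (h0 : ∀ᶠ σ in atTop, 0 < u σ)
    (h1 : ∀ᶠ σ in atTop, c * σ ≤ Real.log (u σ)) (h2 : ∀ᶠ σ in atTop, u σ ≤ C * σ ^ a) :
    False := by
  have hlo := Real.isLittleO_log_id_atTop.bound (show 0 < c / (2 * a) by positivity)
  obtain ⟨σ, h0, h1, h2, h3, h4, h5⟩ := (h0.and (h1.and (h2.and (hlo.and
    ((eventually_gt_atTop 0).and (eventually_gt_atTop (2 * Real.log C / c))))))).exists
  rw [id, Real.norm_of_nonneg h4.le] at h3
  have h6 := (le_abs_self _).trans h3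
  have h7 := Real.log_le_log h0 h2
  rw [Real.log_mul hC.ne' (Real.rpow_pos_of_pos h4 a).ne', Real.log_rpow h4] at h7
  have h8 : a * Real.log σ ≤ a * (c / (2 * a) * σ) := by gcongr
  have h9 : a * (c / (2 * a) * σ) = c * σ / 2 := by field_simp
  rw [div_lt_iff₀ hc] at h5
  linarith

lemma log_ratio_tendsto {B P : ℝ → ℝ} (hB : Tendsto B atTop atTop) {c C e : ℝ} (hc : 0 < c)
    (hC : 0 < C) (h1 : ∀ᶠ σ in atTop, c * B σ ^ e ≤ P σ)
    (h2 : ∀ᶠ σ in atTop, P σ ≤ C * B σ ^ e) :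
    Tendsto (fun σ => Real.log (P σ) / Real.log (B σ)) atTop (𝓝 e) := by
  have hL : Tendsto (fun σ => Real.log (B σ)) atTop atTop := Real.tendsto_log_atTop.comp hB
  have lim : ∀ x : ℝ, Tendsto (fun σ => x / Real.log (B σ) + e) atTop (𝓝 e) := by
    intro x
    simpa using (hL.const_div_atTop x).add_const e
  refine tendsto_of_tendsto_of_tendsto_of_le_of_le' (lim (Real.log c)) (lim (Real.log C)) ?_ ?_
  · filter_upwards [h1, hB.eventually_gt_atTop 0, hL.eventually_gt_atTop 0] with σ h hb hl
    have hp := Real.rpow_pos_of_pos hb e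
    have := Real.log_le_log (by positivity) h
    rw [Real.log_mul hc.ne' hp.ne', Real.log_rpow hb] at this
    rw [le_div_iff₀ hl, add_mul, div_mul_cancel₀ _ hl.ne']
    exact this
  · filter_upwards [h1, h2, hB.eventually_gt_atTop 0, hL.eventually_gt_atTop 0] with σ h' h hb hl
    have hp := Real.rpow_pos_of_pos hb e
    have hPp : 0 < P σ := lt_of_lt_of_le (by positivity) h'
    have := Real.log_le_log hPp h
    rw [Real.log_mul hC.ne' hp.ne', Real.log_rpow hb] at this
    rw [div_le_iff₀ hl, add_mul, div_mul_cancel₀ _ hl.ne']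
    exact this

/-- regularity of the composed growth -/
lemma core_log {u v B P μ : ℝ → ℝ} {a r τ τb T Tb : ℝ} (hr : 0 < r)
    (hB : Tendsto B atTop atTop) (hP : Tendsto P atTop atTop) (hμ : Tendsto μ atTop atTop)
    (hcomp : ∀ᶠ σ in atTop, v (μ σ) = u σ) (hτ0 : 0 < τ) (hτb0 : 0 < τb) (hT0 : 0 < T)
    (hTb0 : 0 < Tb)
    (hτ : liminf (fun σ => ((u σ / B σ ^ a : ℝ) : EReal)) atTop = (τ : EReal))
    (hτb : limsup (fun σ => ((u σ / B σ ^ a : ℝ) : EReal)) atTop = (τb : EReal))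
    (hT : liminf (fun σ => ((v σ / P σ ^ r : ℝ) : EReal)) atTop = (T : EReal))
    (hTb : limsup (fun σ => ((v σ / P σ ^ r : ℝ) : EReal)) atTop = (Tb : EReal)) :
    Tendsto (fun σ => Real.log (P (μ σ)) / Real.log (B σ)) atTop (𝓝 (a / r)) := by
  have B1 := ev_ge_of_liminf hτ (half_lt_self hτ0) (ev_rpow_pos hB a)
  have B2 := ev_le_of_limsup hτb (lt_two_mul_self hτb0) (ev_rpow_pos hB a)
  have P1 := hμ.eventually (ev_ge_of_liminf hT (half_lt_self hT0) (ev_rpow_pos hP r))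
  have P2 := hμ.eventually (ev_le_of_limsup hTb (lt_two_mul_self hTb0) (ev_rpow_pos hP r))
  have hk : ∀ x y : ℝ, 0 < x → 0 < y → x / ((x / y) ^ (1 / r)) ^ r = y := by
    intro x y hx hy
    rw [← Real.rpow_mul (by positivity), one_div_mul_cancel hr.ne', Real.rpow_one]
    field_simp
  refine log_ratio_tendsto hB (c := (τ / 2 / (2 * Tb)) ^ (1 / r))
    (C := (2 * τb / (T / 2)) ^ (1 / r)) (by positivity) (by positivity) ?_ ?_
  · filter_upwards [B1, P2, hcomp, hB.eventually_gt_atTop 0,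
      (hP.comp hμ).eventually_gt_atTop 0] with σ h1 h2 h3 h4 h5
    refine (alg_iff (a := a) (t := τ / 2) (by positivity) h4 h5 hr (by positivity)).1.1 ?_
    rw [hk _ _ (by positivity) (by positivity)]
    rw [h3] at h2
    exact h1.trans h2
  · filter_upwards [B2, P1, hcomp, hB.eventually_gt_atTop 0,
      (hP.comp hμ).eventually_gt_atTop 0] with σ h1 h2 h3 h4 h5
    refine (alg_iff (a := a) (t := 2 * τb) (by positivity) h4 h5 hr (by positivity)).2.1 ?_
    rw [hk _ _ (by positivity) (by positivity)]
    rw [h3] at h2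
    exact h2.trans h1

lemma ereal_real {x : EReal} (h0 : 0 < x) (h1 : x < ⊤) : ∃ r : ℝ, 0 < r ∧ x = (r : EReal) := by
  induction x with
  | bot => simp at h0
  | top => simp at h1
  | coe r => exact ⟨r, by exact_mod_cast h0, rfl⟩

end RealCore

theorem stmt_12 (f : VVDS E) (g : VVDS F) (h : VVDS G) (p q m : ℕ)
    (hf1 : (0 : EReal) < relRittLowerOrder m q f h)
    (hf2 : relRittLowerOrder m q f h ≤ relRittOrder m q f h)
    (hf3 : relRittOrder m q f h < ⊤)
    (hg1 : (0 : EReal) < relRittLowerOrder m p g h)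
    (hg2 : relRittLowerOrder m p g h ≤ relRittOrder m p g h)
    (hg3 : relRittOrder m p g h < ⊤)
    (htf1 : (0 : EReal) < relRittWeakType m q f h)
    (htf2 : relRittWeakType m q f h < ⊤)
    (htbf1 : (0 : EReal) < relRittUpperWeakType m q f h)
    (htbf2 : relRittUpperWeakType m q f h < ⊤)
    (htbg1 : (0 : EReal) < relRittUpperWeakType m p g h)
    (htbg2 : relRittUpperWeakType m p g h < ⊤)
    (hDg1 : (0 : EReal) < relRittType m p g h)
    (hDg2 : relRittType m p g h < ⊤)
    (hDbg1 : (0 : EReal) < relRittLowerType m p g h)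
    (hDbg2 : relRittLowerType m p g h < ⊤)
    :
    (((((relRittWeakType m q f h).toReal / (relRittUpperWeakType m p g h).toReal) ^ (1 / (relRittLowerOrder m p g h).toReal)) : ℝ) : EReal) ≤ relRittWeakType p q f g ∧ relRittWeakType p q f g ≤ ((min (((relRittWeakType m q f h).toReal / (relRittLowerType m p g h).toReal) ^ (1 / (relRittOrder m p g h).toReal)) (((relRittUpperWeakType m q f h).toReal / (relRittType m p g h).toReal) ^ (1 / (relRittOrder m p g h).toReal)) : ℝ) : EReal) := by
  have hfo1 : relRittLowerOrder m q f h < ⊤ := hf2.trans_lt hf3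
  have hfo2 : 0 < relRittOrder m q f h := hf1.trans_le hf2
  have hgo1 : relRittLowerOrder m p g h < ⊤ := hg2.trans_lt hg3
  have hgo2 : 0 < relRittOrder m p g h := hg1.trans_le hg2
  obtain ⟨a, ha0, ha⟩ := ereal_real hf1 hfo1
  obtain ⟨ρf, hρf0, hρf⟩ := ereal_real hfo2 hf3
  obtain ⟨l, hl0, hl⟩ := ereal_real hg1 hgo1
  obtain ⟨r, hr0, hr⟩ := ereal_real hgo2 hg3
  obtain ⟨τ, hτ0, hτ⟩ := ereal_real htf1 htf2
  obtain ⟨τb, hτb0, hτb⟩ := ereal_real htbf1 htbf2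
  obtain ⟨Tg, hTg0, hTg⟩ := ereal_real htbg1 htbg2
  obtain ⟨D, hD0, hD⟩ := ereal_real hDg1 hDg2
  obtain ⟨Db, hDb0, hDb⟩ := ereal_real hDbg1 hDbg2
  rw [hτ, hτb, hTg, hD, hDb, hl, hr]
  simp only [EReal.toReal_coe]
  -- the functions
  set H : ℝ → ℝ := fun y => Real.log^[m-1] (h.Minv y) with hH
  set u : ℝ → ℝ := fun σ => H (f.M σ) with hu
  set v : ℝ → ℝ := fun σ => H (g.M σ) with hv
  set μ : ℝ → ℝ := fun σ => g.Minv (f.M σ) with hμdef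
  set κ : ℝ → ℝ := fun s => f.Minv (g.M s) with hκdef
  have hB := log_iter_tendsto (q - 1)
  have hP := log_iter_tendsto (p - 1)
  set B : ℝ → ℝ := Real.log^[q-1] with hBdef
  set P : ℝ → ℝ := Real.log^[p-1] with hPdef
  have hmonP : ∃ K : ℝ, MonotoneOn P (Set.Ici K) := log_iter_mono (p - 1)
  have hμ : Tendsto μ atTop atTop := g.Minv_tendsto.comp f.M_tendsto
  have hκ : Tendsto κ atTop atTop := f.Minv_tendsto.comp g.M_tendsto
  have hcomp : ∀ᶠ σ in atTop, v (μ σ) = u σ := by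
    filter_upwards [f.M_tendsto.eventually_gt_atTop (g.S 0)] with σ hσ
    simp only [hv, hu, hμdef]
    rw [(g.Minv_spec hσ).1]
  have hκμ : ∀ᶠ s in atTop, v (μ (κ s)) = v s ∧ μ (κ s) ≤ s := by
    filter_upwards [g.M_tendsto.eventually_gt_atTop (f.S 0),
      g.M_tendsto.eventually_gt_atTop (g.S 0)] with s h1 h2
    simp only [hv, hμdef, hκdef]
    rw [(f.Minv_spec h1).1, (g.Minv_spec h2).1]
    exact ⟨rfl, (g.Minv_spec h2).2 s le_rfl⟩
  -- the types
  have Hτ : liminf (fun σ => ((u σ / B σ ^ a : ℝ) : EReal)) atTop = (τ : EReal) := by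
    rw [← hτ, relRittWeakType, ha, EReal.toReal_coe]
  have Hτb : limsup (fun σ => ((u σ / B σ ^ a : ℝ) : EReal)) atTop = (τb : EReal) := by
    rw [← hτb, relRittUpperWeakType, ha, EReal.toReal_coe]
  have HTg : limsup (fun σ => ((v σ / P σ ^ l : ℝ) : EReal)) atTop = (Tg : EReal) := by
    rw [← hTg, relRittUpperWeakType, hl, EReal.toReal_coe]
  have HD : limsup (fun σ => ((v σ / P σ ^ r : ℝ) : EReal)) atTop = (D : EReal) := by
    rw [← hD, relRittType, hr, EReal.toReal_coe]
  have HDb : liminf (fun σ => ((v σ / P σ ^ r : ℝ) : EReal)) atTop = (Db : EReal) := by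
    rw [← hDb, relRittLowerType, hr, EReal.toReal_coe]
  have U1 := ev_ge_of_liminf Hτ (half_lt_self hτ0) (ev_rpow_pos hB a)
  have U2 := ev_le_of_limsup Hτb (lt_two_mul_self hτb0) (ev_rpow_pos hB a)
  have V1 := ev_ge_of_liminf HDb (half_lt_self hDb0) (ev_rpow_pos hP r)
  have V2 := ev_le_of_limsup HTg (lt_two_mul_self hTg0) (ev_rpow_pos hP l)
  have hlr : l = r := by
    refine le_antisymm (by rw [hl, hr] at hg2; exact_mod_cast hg2) ?_
    refine exponent_le hP (c := Db / 2) (C := 2 * Tg) (by positivity) ?_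
    filter_upwards [V1, V2] with s h1 h2 using h1.trans h2
  subst hlr
  have hTD : Tg = D := by
    have := HTg.symm.trans HD
    exact_mod_cast this
  subst hTD
  have upos : ∀ᶠ σ in atTop, 0 < u σ := by
    filter_upwards [U1, ev_rpow_pos hB a] with σ h1 h2
    exact lt_of_lt_of_le (by positivity) h1
  have vpos : ∀ᶠ σ in atTop, 0 < v σ := by
    filter_upwards [V1, ev_rpow_pos hP l] with σ h1 h2
    exact lt_of_lt_of_le (by positivity) h1
  have C1 := core_lower hr0 hB hP hμ hcomp hτ0 hTg0 Hτ HTg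
  have C2 := core_upper1 hr0 hB hP hμ hcomp hτ0 hDb0 Hτ HDb
  have C3 := core_upper2 hr0 hB hP hμ hκ hmonP hcomp hκμ hτb0 hTg0 Hτb HTg
  suffices hreg : relRittLowerOrder p q f g = ((a / l : ℝ) : EReal) by
    have hw : relRittWeakType p q f g =
        liminf (fun σ => ((P (μ σ) / B σ ^ (a / l) : ℝ) : EReal)) atTop := by
      rw [relRittWeakType, hreg, EReal.toReal_coe]
    rw [hw]
    refine ⟨C1, ?_⟩
    rcases min_choice ((τ / Db) ^ (1 / l)) ((τb / Tg) ^ (1 / l)) with h | h <;> rw [h]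
    · exact C2
    · exact C3
  rcases m with _ | m
  · -- m = 0
    rcases q with _ | q
    swap
    · exfalso
      rw [relRittOrder] at hρf
      have hlog : ∀ᶠ σ in atTop, 0 < Real.log^[q + 1] σ :=
        (log_iter_tendsto (q + 1)).eventually_gt_atTop 0
      have h1 := ev_le_of_limsup hρf (lt_two_mul_self hρf0) hlog
      simp only [Function.iterate_succ_apply'] at h1
      exact contra_log hB (by positivity) ha0 (by positivity) h1 U1
    rcases p with _ | p
    swap
    · exfalso
      rw [relRittOrder] at hr
      have hlog : ∀ᶠ σ in atTop, 0 < Real.log^[p + 1] σ :=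
        (log_iter_tendsto (p + 1)).eventually_gt_atTop 0
      have h1 := ev_le_of_limsup hr (lt_two_mul_self hr0) hlog
      simp only [Function.iterate_succ_apply'] at h1
      exact contra_log hP (by positivity) hr0 (by positivity) h1 V1
    -- m = p = q = 0
    have ha' : liminf (fun σ => ((u σ / B σ : ℝ) : EReal)) atTop = (a : EReal) := ha
    have hρf' : limsup (fun σ => ((u σ / B σ : ℝ) : EReal)) atTop = (ρf : EReal) := hρf
    have hl' : liminf (fun σ => ((v σ / P σ : ℝ) : EReal)) atTop = (l : EReal) := hl
    have hr' : limsup (fun σ => ((v σ / P σ : ℝ) : EReal)) atTop = (l : EReal) := hr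
    have O1 := ev_ge_of_liminf ha' (half_lt_self ha0) (hB.eventually_gt_atTop 0)
    have O2 := ev_le_of_limsup hρf' (lt_two_mul_self hρf0) (hB.eventually_gt_atTop 0)
    have Q1 := ev_ge_of_liminf hl' (half_lt_self hl0) (hP.eventually_gt_atTop 0)
    have Q2 := ev_le_of_limsup hr' (lt_two_mul_self hr0) (hP.eventually_gt_atTop 0)
    have ha1 : a = 1 := by
      apply le_antisymm
      · refine exponent_le hB (c := τ / 2) (C := 2 * ρf) (by positivity) ?_
        filter_upwards [U1, O2] with σ h1 h2
        rw [Real.rpow_one]; exact h1.trans h2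
      · refine exponent_le hB (c := a / 2) (C := 2 * τb) (by positivity) ?_
        filter_upwards [U2, O1] with σ h1 h2
        rw [Real.rpow_one]; exact h2.trans h1
    have hl1 : l = 1 := by
      apply le_antisymm
      · refine exponent_le hP (c := Db / 2) (C := 2 * l) (by positivity) ?_
        filter_upwards [V1, Q2] with σ h1 h2
        rw [Real.rpow_one]; exact h1.trans h2
      · refine exponent_le hP (c := l / 2) (C := 2 * Tg) (by positivity) ?_
        filter_upwards [V2, Q1] with σ h1 h2
        rw [Real.rpow_one]; exact h2.trans h1
    subst ha1
    subst hl1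
    simp only [Real.rpow_one] at Hτ HTg HDb
    have e1 : τ = 1 := by exact_mod_cast Hτ.symm.trans ha'
    have e2 : Tg = 1 := by exact_mod_cast HTg.symm.trans hr'
    have e3 : Db = 1 := by exact_mod_cast HDb.symm.trans hl'
    rw [e1, e2] at C1
    rw [e1, e3] at C2
    have hfin : relRittLowerOrder 0 0 f g =
        liminf (fun σ => ((P (μ σ) / B σ : ℝ) : EReal)) atTop := rfl
    rw [hfin]
    simp only [div_one, Real.rpow_one] at C1 C2
    simp only [div_one]
    exact le_antisymm C2 C1
  · rcases q with _ | q
    · exfalso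
      rw [relRittLowerOrder] at ha
      have h1 := ev_ge_of_liminf ha (half_lt_self ha0) (eventually_gt_atTop 0)
      simp only [Function.iterate_succ_apply'] at h1
      exact contra_exp (by positivity) ha0 (by positivity) upos h1 U2
    rcases p with _ | p
    · exfalso
      rw [relRittLowerOrder] at hl
      have h1 := ev_ge_of_liminf hl (half_lt_self hl0) (eventually_gt_atTop 0)
      simp only [Function.iterate_succ_apply'] at h1
      exact contra_exp (by positivity) hl0 (by positivity) vpos h1 V2
    have hlim := core_log hr0 hB hP hμ hcomp hτ0 hτb0 hDb0 hTg0 Hτ Hτb HDb HTg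
    have hfin : relRittLowerOrder (p + 1) (q + 1) f g =
        liminf (fun σ => ((Real.log (P (μ σ)) / Real.log (B σ) : ℝ) : EReal)) atTop := by
      rw [relRittLowerOrder]
      simp only [Function.iterate_succ_apply']
      rfl
    rw [hfin]
    exact ((continuous_coe_real_ereal.tendsto _).comp hlim).liminf_eq
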